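/- arXiv:2505.13578 — 5 statements merged into one kernel-verified Lean document; each statement's English description precedes it below -/
import Mathlib

section
/- Let (X, μ) be a measure space with μ ≠ 0, d ≥ 1, and let e : X → EuclideanSpace ℝ (Fin d) be measurable. Let β > 0, v > 0, c ∈ EuclideanSpace ℝ (Fin d), and set μ₀ := 2*β*(‖c‖² - v²). Assume: (i) (trivial stabilizer / ker E = {0}) for every c' ∈ EuclideanSpace ℝ (Fin d), if ⟪e x, c'⟫ = 0 for μ-almost every x then c' = 0; (ii) (nondegeneracy) there is no fixed vector w ∈ EuclideanSpace ℝ (Fin d) such that for μ-almost every x, e x = w or e x = -w; (iii) (Euler–Lagrange equation for a constant field) for μ-almost every x, ⟪e x, c⟫ • (e x) + μ₀ • c = 0. Then c = 0. (Lemma 1: in the generic case, the only constant critical point of the auxiliary energies (a) and (b) is the zero field.) -/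
open scoped InnerProductSpace
open MeasureTheory

/-- Lemma 1 (no nontrivial constant minimizers, generic case): if the stabilizer is
trivial (`ker E = {0}`), the orbit-direction field `e` does not have simultaneously
constant direction and constant magnitude, and the constant field `c` satisfies the
Euler–Lagrange equation `⟪e x, c⟫ e x + μ₀ c = 0` a.e. with `μ₀ = 2β(‖c‖² - v²)`,
then `c = 0`. -/
theorem no_nontrivial_constant_minimizer
    {X : Type*} [MeasurableSpace X] (μ : Measure X) (hμ : μ ≠ 0)
    (d : ℕ) (hd : 1 ≤ d)
    (e : X → EuclideanSpace ℝ (Fin d)) (he : Measurable e)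
    (β v : ℝ) (hβ : 0 < β) (hv : 0 < v)
    (c : EuclideanSpace ℝ (Fin d)) (μ₀ : ℝ)
    (hμ₀ : μ₀ = 2 * β * (‖c‖ ^ 2 - v ^ 2))
    (hker : ∀ c' : EuclideanSpace ℝ (Fin d),
      (∀ᵐ x ∂μ, ⟪e x, c'⟫_ℝ = 0) → c' = 0)
    (hnondeg : ¬ ∃ w : EuclideanSpace ℝ (Fin d), ∀ᵐ x ∂μ, e x = w ∨ e x = -w)
    (hEL : ∀ᵐ x ∂μ, ⟪e x, c⟫_ℝ • (e x) + μ₀ • c = 0) :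
    c = 0 := by
  by_contra hc
  have hn : ‖c‖ ^ 2 ≠ 0 := by simpa using hc
  have hsq : ∀ᵐ x ∂μ, ⟪e x, c⟫_ℝ ^ 2 = -μ₀ * ‖c‖ ^ 2 := by
    filter_upwards [hEL] with x hx
    have h := congrArg (fun y => ⟪y, c⟫_ℝ) hx
    simp only [inner_add_left, real_inner_smul_left, inner_zero_left,
      real_inner_self_eq_norm_sq] at h
    linarith
  by_cases h0 : μ₀ = 0
  · refine hc (hker c ?_)
    filter_upwards [hsq] with x hx
    simpa [h0] using hx
  · refine hnondeg ⟨(-μ₀ / √(-μ₀ * ‖c‖ ^ 2)) • c, ?_⟩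
    filter_upwards [hEL, hsq] with x hx hs
    have hs0 : ⟪e x, c⟫_ℝ ≠ 0 := by
      intro h
      rw [h] at hs
      exact mul_ne_zero (neg_ne_zero.mpr h0) hn (by simpa using hs.symm)
    have hex : e x = (-μ₀ / ⟪e x, c⟫_ℝ) • c := by
      rw [div_eq_inv_mul, mul_smul, neg_smul, ← eq_neg_of_add_eq_zero_left hx,
        inv_smul_smul₀ hs0]
    rw [← hs, Real.sqrt_sq_eq_abs]
    rcases abs_choice ⟪e x, c⟫_ℝ with h | h
    · left
      rw [h]
      exact hex
    · right
      rw [h, div_neg, neg_smul, neg_neg]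
      exact hex
end

section
/- Let m ≥ 2, let E := EuclideanSpace ℝ (Fin m), let σ be the uniform (rotation-invariant) probability measure on the unit sphere {x ∈ E : ‖x‖ = 1}, let a ∈ E with ‖a‖ = 1, and let τ ∈ [0, 1]. Then σ {u : τ ≤ |⟪u, a⟫|} = (2 * ∫_{τ}^{1} (1 - z²)^{(m-3)/2} dz) / (∫_{-1}^{1} (1 - z²)^{(m-3)/2} dz). (Lemma 2, density form: the coordinate Z = ⟨u, a⟩ of a uniform random unit vector has density proportional to (1−z²)^{(m−3)/2} on [−1,1], and the two-sided tail probability is the corresponding normalized integral.) -/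
open scoped InnerProductSpace
open MeasureTheory

/-- The restriction of a linear isometry equivalence of `E` to the unit sphere. -/
noncomputable def sphereMap {E : Type*} [NormedAddCommGroup E] [InnerProductSpace ℝ E]
    (f : E ≃ₗᵢ[ℝ] E) (u : Metric.sphere (0 : E) 1) : Metric.sphere (0 : E) 1 :=
  ⟨f u, by
    have hu := u.2
    simp only [Metric.mem_sphere, dist_zero_right] at hu ⊢
    rw [f.norm_map]
    exact hu⟩

open Set Metric
open scoped ENNReal

section

variable {E : Type*} [NormedAddCommGroup E] [InnerProductSpace ℝ E]

theorem exists_linearIsometryEquiv_apply_eq {v w : E} (h : ‖v‖ = ‖w‖) :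
    ∃ f : E ≃ₗᵢ[ℝ] E, f v = w :=
  ⟨_, Submodule.reflection_sub h⟩

theorem continuous_sphereMap (f : E ≃ₗᵢ[ℝ] E) : Continuous (sphereMap f) :=
  (f.continuous.comp continuous_subtype_val).subtype_mk _

variable [MeasurableSpace E] [BorelSpace E]

/-- Two-sided cap probabilities of an invariant measure do not depend on the centre. -/
theorem measure_sphere_cap_eq {σ : Measure (sphere (0 : E) 1)}
    (hinv : ∀ f : E ≃ₗᵢ[ℝ] E, Measure.map (sphereMap f) σ = σ)
    {v w : E} (h : ‖v‖ = ‖w‖) (t : ℝ) :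
    σ {u | t ≤ |⟪(u : E), v⟫_ℝ|} = σ {u | t ≤ |⟪(u : E), w⟫_ℝ|} := by
  obtain ⟨f, rfl⟩ := exists_linearIsometryEquiv_apply_eq h
  have hm : MeasurableSet {u : sphere (0 : E) 1 | t ≤ |⟪(u : E), f v⟫_ℝ|} :=
    (isClosed_le continuous_const (by fun_prop)).measurableSet
  conv_rhs => rw [← hinv f, Measure.map_apply (continuous_sphereMap f).measurable hm]
  simp [sphereMap]

/-- Solid double cones in the unit ball with axes of the same length have the same volume. -/
theorem volume_cone_inter_ball_eq [FiniteDimensional ℝ E] {v w : E} (h : ‖v‖ = ‖w‖) (t : ℝ) :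
    volume {x : E | t * ‖x‖ ≤ |⟪v, x⟫_ℝ| ∧ ‖x‖ < 1} =
      volume {x : E | t * ‖x‖ ≤ |⟪w, x⟫_ℝ| ∧ ‖x‖ < 1} := by
  obtain ⟨f, rfl⟩ := exists_linearIsometryEquiv_apply_eq h
  conv_rhs => rw [← f.measurePreserving.measure_preimage_emb f.toMeasurableEquiv.measurableEmbedding]
  simp

/-- The probability of a two-sided cap is the volume fraction of the corresponding double cone
in the unit ball. -/
theorem measure_sphere_cap_mul_volume_ball [FiniteDimensional ℝ E] [Nontrivial E]
    {σ : Measure (sphere (0 : E) 1)} [IsProbabilityMeasure σ]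
    (hinv : ∀ f : E ≃ₗᵢ[ℝ] E, Measure.map (sphereMap f) σ = σ)
    {a b : E} (ha : ‖a‖ = 1) (hb : ‖b‖ = 1) (t : ℝ) :
    σ {u | t ≤ |⟪(u : E), a⟫_ℝ|} * volume (ball (0 : E) 1) =
      volume {x : E | t * ‖x‖ ≤ |⟪b, x⟫_ℝ| ∧ ‖x‖ < 1} := by
  set ν : Measure E := volume.restrict (ball 0 1)
  set S : Set (sphere (0 : E) 1 × E) := {p | t * ‖p.2‖ ≤ |⟪(p.1 : E), p.2⟫_ℝ|}
  have hS : MeasurableSet S :=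
    (isClosed_le (by fun_prop) (by fun_prop)).measurableSet
  have h1 : σ.prod ν S = σ {u | t ≤ |⟪(u : E), a⟫_ℝ|} * volume (ball (0 : E) 1) := by
    rw [Measure.prod_apply_symm hS]
    have hae : ∀ᵐ x ∂ν, σ ((fun u => (u, x)) ⁻¹' S) = σ {u | t ≤ |⟪(u : E), a⟫_ℝ|} := by
      have h0 : ∀ᵐ x ∂ν, x ≠ 0 := ae_restrict_of_ae (Measure.ae_ne _ 0)
      filter_upwards [h0] with x hx
      have hx' : 0 < ‖x‖ := norm_pos_iff.2 hx
      rw [measure_sphere_cap_eq hinv (v := a) (w := ‖x‖⁻¹ • x)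
        (by rw [ha, norm_smul, norm_inv, norm_norm, inv_mul_cancel₀ hx'.ne'])]
      congr 1
      ext u
      simp only [S, mem_preimage, mem_ofPred_eq, inner_smul_right, abs_mul, abs_inv, abs_norm]
      rw [← div_eq_inv_mul, le_div_iff₀ hx']
    rw [lintegral_congr_ae hae, lintegral_const, Measure.restrict_apply_univ]
  have h2 : σ.prod ν S = volume {x : E | t * ‖x‖ ≤ |⟪b, x⟫_ℝ| ∧ ‖x‖ < 1} := by
    rw [Measure.prod_apply hS]
    have hc (u : sphere (0 : E) 1) : ν (Prod.mk u ⁻¹' S) =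
        volume {x : E | t * ‖x‖ ≤ |⟪b, x⟫_ℝ| ∧ ‖x‖ < 1} := by
      rw [← volume_cone_inter_ball_eq (v := (u : E)) (w := b) (by rw [hb]; simp),
        Measure.restrict_apply' measurableSet_ball]
      congr 1
      ext x
      simp [S]
    simp [hc]
  rw [← h1, h2]

end

section

variable {F : Type*} [NormedAddCommGroup F] [NormedSpace ℝ F] [MeasurableSpace F] [BorelSpace F]
  [FiniteDimensional ℝ F] [Nontrivial F]

/-- Integration of a radial function in polar coordinates. -/
theorem lintegral_fun_norm_addHaar (μ : Measure F) [μ.IsAddHaarMeasure] {f : ℝ → ℝ≥0∞}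
    (hf : Measurable f) :
    ∫⁻ x, f ‖x‖ ∂μ = μ.toSphere univ *
      ∫⁻ r in Ioi (0 : ℝ), ENNReal.ofReal (r ^ (Module.finrank ℝ F - 1)) * f r := by
  calc
    ∫⁻ x, f ‖x‖ ∂μ = ∫⁻ x : ({0}ᶜ : Set F), f ‖x.1‖ ∂(μ.comap (↑)) := by
      rw [lintegral_subtype_comap (measurableSet_singleton _).compl fun x ↦ f ‖x‖,
        restrict_compl_singleton]
    _ = ∫⁻ p, f p.2 ∂(μ.toSphere.prod (.volumeIoiPow (Module.finrank ℝ F - 1))) := by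
      rw [← μ.measurePreserving_homeomorphUnitSphereProd.lintegral_comp_emb
        (Homeomorph.measurableEmbedding _)]
      simp
    _ = _ := by
      rw [lintegral_prod _ (by fun_prop)]
      dsimp only
      rw [lintegral_const, mul_comm, Measure.volumeIoiPow,
        lintegral_withDensity_eq_lintegral_mul _ (by fun_prop) (by fun_prop)]
      congr 1
      exact lintegral_subtype_comap measurableSet_Ioi
        (fun r : ℝ => ENNReal.ofReal (r ^ (Module.finrank ℝ F - 1)) * f r)

end

section

open Real

/-- The substitution `z = cos θ`. -/
theorem lintegral_sin_pow_mul_cos {n : ℕ} (hn : 1 ≤ n) (q : ℝ → ℝ≥0∞) :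
    ∫⁻ θ in Ioo 0 π, ENNReal.ofReal (sin θ ^ (n - 1)) * q (cos θ) =
      ∫⁻ z in Ioo (-1) 1, ENNReal.ofReal ((1 - z ^ 2) ^ (((n : ℝ) - 2) / 2)) * q z := by
  have himage : cos '' Ioo 0 π = Ioo (-1) 1 := by
    ext z
    constructor
    · rintro ⟨θ, hθ, rfl⟩
      have hs := sin_pos_of_pos_of_lt_pi hθ.1 hθ.2
      have := sin_sq_add_cos_sq θ
      constructor <;> nlinarith
    · intro hz
      exact ⟨arccos z, ⟨arccos_pos.2 hz.2, (arccos_lt_pi.2 hz.1)⟩,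
        cos_arccos hz.1.le hz.2.le⟩
  rw [← himage, lintegral_image_eq_lintegral_abs_deriv_mul measurableSet_Ioo
    (fun θ _ => (hasDerivAt_cos θ).hasDerivWithinAt) (injOn_cos.mono Ioo_subset_Icc_self)]
  refine setLIntegral_congr_fun measurableSet_Ioo fun θ hθ => ?_
  have hs : 0 < sin θ := sin_pos_of_pos_of_lt_pi hθ.1 hθ.2
  have hpow : sin θ ^ (n - 1) = |-sin θ| * (1 - cos θ ^ 2) ^ (((n : ℝ) - 2) / 2) := by
    rw [abs_neg, abs_of_pos hs, ← sin_sq, ← rpow_natCast (sin θ) 2, ← rpow_mul hs.le,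
      mul_comm (sin θ), ← rpow_add_one hs.ne', ← rpow_natCast, Nat.cast_sub hn]
    congr 1
    push_cast
    ring
  simp only [hpow, ENNReal.ofReal_mul (abs_nonneg _), mul_assoc]

/-- Integration over the upper half-plane in polar coordinates, for a function which is a product
of a radial part, a function of the cosine of the angle and a power of the height. -/
theorem lintegral_half_plane_polar {n : ℕ} (hn : 1 ≤ n) {g q : ℝ → ℝ≥0∞} (hg : Measurable g)
    (hq : Measurable q) :
    ∫⁻ s : ℝ, ∫⁻ r in Ioi (0 : ℝ), ENNReal.ofReal (r ^ (n - 1)) *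
        (g (√(s ^ 2 + r ^ 2)) * q (s / √(s ^ 2 + r ^ 2))) =
      (∫⁻ ρ in Ioi (0 : ℝ), ENNReal.ofReal (ρ ^ n) * g ρ) *
        ∫⁻ z in Ioo (-1) 1, ENNReal.ofReal ((1 - z ^ 2) ^ (((n : ℝ) - 2) / 2)) * q z := by
  set G : ℝ × ℝ → ℝ≥0∞ := fun p => (Ioi (0 : ℝ)).indicator (fun r => ENNReal.ofReal (r ^ (n - 1)) *
        (g (√(p.1 ^ 2 + r ^ 2)) * q (p.1 / √(p.1 ^ 2 + r ^ 2)))) p.2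
  have hG : Measurable G := by
    have : G = (univ ×ˢ Ioi (0 : ℝ)).indicator (fun p => ENNReal.ofReal (p.2 ^ (n - 1)) *
        (g (√(p.1 ^ 2 + p.2 ^ 2)) * q (p.1 / √(p.1 ^ 2 + p.2 ^ 2)))) := by
      ext p
      simp [G, indicator]
    rw [this]
    exact Measurable.indicator (by fun_prop) (MeasurableSet.univ.prod measurableSet_Ioi)
  set B : ℝ → ℝ≥0∞ := (Ioo 0 π).indicator
    fun θ => ENNReal.ofReal (sin θ ^ (n - 1)) * q (cos θ)
  have hB : Measurable B := Measurable.indicator (by fun_prop) measurableSet_Ioo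
  calc
    _ = ∫⁻ p, G p := by
      rw [Measure.volume_eq_prod, lintegral_prod _ hG.aemeasurable]
      simp only [G, lintegral_indicator measurableSet_Ioi]
    _ = ∫⁻ p in Ioi (0 : ℝ) ×ˢ Ioo (-π) π, (ENNReal.ofReal (p.1 ^ n) * g p.1) * B p.2 := by
      rw [← lintegral_comp_polarCoord_symm]
      refine setLIntegral_congr_fun (measurableSet_Ioi.prod measurableSet_Ioo) ?_
      rintro ⟨ρ, θ⟩ ⟨hρ, hθ⟩
      replace hρ : 0 < ρ := hρ
      simp only [polarCoord_symm_apply, G, B, smul_eq_mul]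
      have hsqrt : √((ρ * cos θ) ^ 2 + (ρ * sin θ) ^ 2) = ρ := by
        rw [show (ρ * cos θ) ^ 2 + (ρ * sin θ) ^ 2 = ρ ^ 2 * (sin θ ^ 2 + cos θ ^ 2) by ring,
          sin_sq_add_cos_sq, mul_one, sqrt_sq hρ.le]
      by_cases h0 : 0 < θ
      · have hs : 0 < sin θ := sin_pos_of_pos_of_lt_pi h0 hθ.2
        rw [indicator_of_mem (mem_Ioi.2 (mul_pos hρ hs)), indicator_of_mem (mem_Ioo.2 ⟨h0, hθ.2⟩),
          hsqrt, mul_div_cancel_left₀ _ hρ.ne', mul_pow,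
          ENNReal.ofReal_mul (by positivity)]
        have : ENNReal.ofReal (ρ ^ n) = ENNReal.ofReal ρ * ENNReal.ofReal (ρ ^ (n - 1)) := by
          rw [← ENNReal.ofReal_mul hρ.le, ← pow_succ', Nat.sub_add_cancel hn]
        rw [this]
        ring
      · have hs : sin θ ≤ 0 := sin_nonpos_of_nonpos_of_neg_pi_le (not_lt.1 h0) hθ.1.le
        rw [indicator_of_notMem, indicator_of_notMem]
        · simp
        · exact fun h => h0 h.1
        · exact not_lt.2 (mul_nonpos_of_nonneg_of_nonpos hρ.le hs)
    _ = (∫⁻ ρ in Ioi (0 : ℝ), ENNReal.ofReal (ρ ^ n) * g ρ) * ∫⁻ θ in Ioo (-π) π, B θ := by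
      rw [Measure.volume_eq_prod, ← Measure.prod_restrict]
      exact lintegral_prod_mul (f := fun ρ => ENNReal.ofReal (ρ ^ n) * g ρ) (g := B)
        (by fun_prop) hB.aemeasurable
    _ = _ := by
      rw [← lintegral_sin_pow_mul_cos hn, setLIntegral_indicator measurableSet_Ioo,
        inter_eq_left.2 (Ioo_subset_Ioo_left (by linarith [pi_pos]))]

variable {F : Type*} [NormedAddCommGroup F] [InnerProductSpace ℝ F] [MeasurableSpace F]
  [BorelSpace F] [FiniteDimensional ℝ F] [Nontrivial F]

/-- The volume of a solid double cone in the unit ball around the first axis of `ℝ × F`. -/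
theorem exists_volume_cone_eq :
    ∃ c : ℝ≥0∞, ∀ t : ℝ, volume {x : WithLp 2 (ℝ × F) | t * ‖x‖ ≤ |x.fst| ∧ ‖x‖ < 1} =
      c * ∫⁻ z in Ioo (-1) 1,
        ENNReal.ofReal ((1 - z ^ 2) ^ (((Module.finrank ℝ F : ℝ) - 2) / 2)) *
          {z : ℝ | t ≤ |z|}.indicator 1 z := by
  set n := Module.finrank ℝ F
  have hn : 1 ≤ n := Module.finrank_pos
  set g : ℝ → ℝ≥0∞ := (Iio 1).indicator 1
  have hg : Measurable g := measurable_one.indicator measurableSet_Iio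
  refine ⟨(volume : Measure F).toSphere univ * ∫⁻ ρ in Ioi (0 : ℝ), ENNReal.ofReal (ρ ^ n) * g ρ,
    fun t => ?_⟩
  set q : ℝ → ℝ≥0∞ := {z : ℝ | t ≤ |z|}.indicator 1
  have hq : Measurable q := measurable_one.indicator
    (isClosed_le continuous_const continuous_abs).measurableSet
  have hle : MeasurableSet {x : WithLp 2 (ℝ × F) | t * ‖x‖ ≤ |x.fst|} :=
    measurableSet_le (by fun_prop) (by fun_prop)
  have hlt : MeasurableSet {x : WithLp 2 (ℝ × F) | ‖x‖ < 1} :=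
    measurableSet_lt (by fun_prop) (by fun_prop)
  have hmeas : MeasurableSet {x : WithLp 2 (ℝ × F) | t * ‖x‖ ≤ |x.fst| ∧ ‖x‖ < 1} :=
    hle.inter hlt
  have hpre := (WithLp.volume_preserving_toLp ℝ F).measurable hmeas
  have hfib (s : ℝ) : ∫⁻ y : F, g (√(s ^ 2 + ‖y‖ ^ 2)) * q (s / √(s ^ 2 + ‖y‖ ^ 2)) =
      (volume : Measure F).toSphere univ * ∫⁻ r in Ioi (0 : ℝ), ENNReal.ofReal (r ^ (n - 1)) *
        (g (√(s ^ 2 + r ^ 2)) * q (s / √(s ^ 2 + r ^ 2))) :=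
    lintegral_fun_norm_addHaar volume
      (f := fun r => g (√(s ^ 2 + r ^ 2)) * q (s / √(s ^ 2 + r ^ 2))) (by fun_prop)
  rw [mul_assoc, ← lintegral_half_plane_polar hn hg hq, ← lintegral_const_mul']
  · simp_rw [← hfib]
    rw [← (WithLp.volume_preserving_toLp ℝ F).measure_preimage hmeas.nullMeasurableSet,
      Measure.volume_eq_prod, ← lintegral_indicator_one hpre,
      lintegral_prod _ (measurable_one.indicator hpre).aemeasurable]
    refine lintegral_congr fun s => lintegral_congr_ae ?_
    filter_upwards [Measure.ae_ne volume (0 : F)] with y hy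
    have hnorm : ‖WithLp.toLp 2 (s, y)‖ = √(s ^ 2 + ‖y‖ ^ 2) := by
      simp [WithLp.prod_norm_eq_of_L2]
    have hpos : 0 < √(s ^ 2 + ‖y‖ ^ 2) := by
      have := norm_pos_iff.2 hy
      positivity
    have hiff : t ≤ |s / √(s ^ 2 + ‖y‖ ^ 2)| ↔ t * √(s ^ 2 + ‖y‖ ^ 2) ≤ |s| := by
      rw [abs_div, abs_of_pos hpos, le_div_iff₀ hpos]
    simp only [g, q, indicator_apply, mem_ofPred_eq, mem_Iio, hiff, Pi.one_apply]
    split_ifs <;> simp_all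
  · exact measure_ne_top _ _

end

/-- Both tails of the weight `(1 - z ^ 2) ^ p` as a single interval integral. -/
theorem lintegral_tails_eq_ofReal {p : ℝ}
    (hint : IntegrableOn (fun z : ℝ => (1 - z ^ 2) ^ p) (Ioo (-1) 1)) {t : ℝ} (ht : t ∈ Icc 0 1) :
    ∫⁻ z in Ioo (-1 : ℝ) 1, ENNReal.ofReal ((1 - z ^ 2) ^ p) * {z : ℝ | t ≤ |z|}.indicator 1 z =
      ENNReal.ofReal (2 * ∫ z in t..1, (1 - z ^ 2) ^ p) := by
  set w : ℝ → ℝ := fun z => (1 - z ^ 2) ^ p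
  set f : ℝ → ℝ := (Ico t 1).indicator w
  have hT : MeasurableSet {z : ℝ | t ≤ |z|} :=
    measurableSet_le measurable_const (by fun_prop)
  have hf : (fun z => f |z|) = (Ioo (-1) 1).indicator ({z : ℝ | t ≤ |z|}.indicator w) := by
    ext z
    have : z ∈ Ioo (-1 : ℝ) 1 ↔ |z| < 1 := abs_lt.symm
    simp only [f, indicator_apply, this, mem_Ico, mem_ofPred_eq, w, sq_abs]
    split_ifs <;> simp_all
  have htwo : ∫ z, f |z| = 2 * ∫ z in t..1, w z := by
    rw [integral_comp_abs, intervalIntegral.integral_of_le ht.2, ← integral_Ici_eq_integral_Ioi,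
      setIntegral_indicator measurableSet_Ico, inter_eq_right.2 (Ico_subset_Ici_self.trans
        (Ici_subset_Ici.2 ht.1)),
      integral_Ico_eq_integral_Ioo, integral_Ioc_eq_integral_Ioo]
  rw [← htwo, hf, integral_indicator measurableSet_Ioo,
    ofReal_integral_eq_lintegral_ofReal (hint.indicator hT)]
  · refine lintegral_congr fun z => ?_
    by_cases hz : z ∈ {z : ℝ | t ≤ |z|} <;> simp [hz, w]
  · filter_upwards [ae_restrict_mem measurableSet_Ioo] with z hz
    rw [indicator_apply]
    split_ifs
    · exact Real.rpow_nonneg (by nlinarith [hz.1, hz.2]) _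
    · exact le_rfl

/-- Lemma 2, density form: the coordinate `Z = ⟪u, a⟫` of a uniform random unit
vector has density proportional to `(1 - z²)^((m-3)/2)` on `[-1, 1]`, and the
two-sided tail probability `σ {u : τ ≤ |⟪u, a⟫|}` is the corresponding normalized
integral. -/
theorem sphere_cap_probability_density_form
    (m : ℕ) (hm : 2 ≤ m)
    (σ : Measure (Metric.sphere (0 : EuclideanSpace ℝ (Fin m)) 1))
    [IsProbabilityMeasure σ]
    (hinv : ∀ f : EuclideanSpace ℝ (Fin m) ≃ₗᵢ[ℝ] EuclideanSpace ℝ (Fin m),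
      Measure.map (sphereMap f) σ = σ)
    (a : EuclideanSpace ℝ (Fin m)) (ha : ‖a‖ = 1)
    (τ : ℝ) (hτ : τ ∈ Set.Icc (0 : ℝ) 1) :
    σ {u : Metric.sphere (0 : EuclideanSpace ℝ (Fin m)) 1 |
        τ ≤ |⟪(u : EuclideanSpace ℝ (Fin m)), a⟫_ℝ|} =
      ENNReal.ofReal
        ((2 * ∫ z in τ..1, (1 - z ^ 2) ^ (((m : ℝ) - 3) / 2)) /
          ∫ z in (-1 : ℝ)..1, (1 - z ^ 2) ^ (((m : ℝ) - 3) / 2)) := by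
  obtain ⟨n, rfl⟩ : ∃ n, m = n + 1 := ⟨m - 1, by omega⟩
  have hn : 1 ≤ n := by omega
  have : Nonempty (Fin n) := ⟨⟨0, hn⟩⟩
  set p : ℝ := (((n + 1 : ℕ) : ℝ) - 3) / 2 with hp
  obtain ⟨c, hc⟩ := exists_volume_cone_eq (F := EuclideanSpace ℝ (Fin n))
  have hexp : ((Module.finrank ℝ (EuclideanSpace ℝ (Fin n)) : ℝ) - 2) / 2 = p := by
    rw [finrank_euclideanSpace_fin, hp]
    push_cast
    ring
  rw [hexp] at hc
  set J : ℝ → ℝ≥0∞ := fun t => ∫⁻ z in Ioo (-1 : ℝ) 1,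
    ENNReal.ofReal ((1 - z ^ 2) ^ p) * {z : ℝ | t ≤ |z|}.indicator 1 z
  have hdim : Module.finrank ℝ (EuclideanSpace ℝ (Fin (n + 1))) =
      Module.finrank ℝ (WithLp 2 (ℝ × EuclideanSpace ℝ (Fin n))) := by
    rw [(WithLp.linearEquiv 2 ℝ (ℝ × EuclideanSpace ℝ (Fin n))).finrank_eq]
    simp [add_comm]
  let φ : EuclideanSpace ℝ (Fin (n + 1)) ≃ₗᵢ[ℝ]
      WithLp 2 (ℝ × EuclideanSpace ℝ (Fin n)) :=
    (stdOrthonormalBasis ℝ _).equiv (stdOrthonormalBasis ℝ _) (finCongr hdim)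
  set b : EuclideanSpace ℝ (Fin (n + 1)) := φ.symm (WithLp.toLp 2 (1, 0))
  have hb : ‖b‖ = 1 := by simp [b]
  have hcone (t : ℝ) : σ {u | t ≤ |⟪(u : EuclideanSpace ℝ (Fin (n + 1))), a⟫_ℝ|} *
      volume (ball (0 : EuclideanSpace ℝ (Fin (n + 1))) 1) = c * J t := by
    rw [measure_sphere_cap_mul_volume_ball hinv ha hb, ← hc,
      ← φ.measurePreserving.measure_preimage_emb φ.toMeasurableEquiv.measurableEmbedding]
    congr 1
    ext x
    have : ⟪b, x⟫_ℝ = (φ x).fst := by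
      rw [← φ.inner_map_map]
      simp [b, WithLp.prod_inner_apply]
    simp [this]
  have hV : volume (ball (0 : EuclideanSpace ℝ (Fin (n + 1))) 1) = c * J 0 := by
    rw [← hcone 0]
    simp
  have hV0 : c * J 0 ≠ 0 := hV ▸ (measure_ball_pos _ _ one_pos).ne'
  have hVtop : c * J 0 ≠ ∞ := hV ▸ measure_ball_lt_top.ne
  have hc0 : c ≠ 0 := left_ne_zero_of_mul hV0
  have hJ0 : J 0 ≠ 0 := right_ne_zero_of_mul hV0
  have hctop : c ≠ ∞ := fun h => hVtop (by rw [h, ENNReal.top_mul hJ0])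
  have hJtop : J 0 ≠ ∞ := fun h => hVtop (by rw [h, ENNReal.mul_top hc0])
  have hJ0_eq : J 0 = ∫⁻ z in Ioo (-1 : ℝ) 1, ENNReal.ofReal ((1 - z ^ 2) ^ p) := by
    simp [J]
  have hnonneg : ∀ᵐ z ∂(volume.restrict (Ioo (-1 : ℝ) 1)), 0 ≤ (1 - z ^ 2) ^ p := by
    filter_upwards [ae_restrict_mem measurableSet_Ioo] with z hz
    exact Real.rpow_nonneg (by nlinarith [hz.1, hz.2]) _
  have hint : IntegrableOn (fun z : ℝ => (1 - z ^ 2) ^ p) (Ioo (-1) 1) := by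
    refine ⟨Measurable.aestronglyMeasurable (by fun_prop), ?_⟩
    rw [hasFiniteIntegral_iff_ofReal hnonneg, ← hJ0_eq]
    exact hJtop.lt_top
  have hden : J 0 = ENNReal.ofReal (∫ z in (-1 : ℝ)..1, (1 - z ^ 2) ^ p) := by
    rw [hJ0_eq, intervalIntegral.integral_of_le (by norm_num), integral_Ioc_eq_integral_Ioo,
      ofReal_integral_eq_lintegral_ofReal hint hnonneg]
  have hpos : 0 < ∫ z in (-1 : ℝ)..1, (1 - z ^ 2) ^ p :=
    ENNReal.ofReal_pos.1 (hden ▸ pos_iff_ne_zero.2 hJ0)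
  rw [ENNReal.ofReal_div_of_pos hpos, ← hden, ← lintegral_tails_eq_ofReal hint hτ,
    ← ENNReal.mul_div_mul_left _ _ hc0 hctop, ENNReal.eq_div_iff hV0 hVtop, mul_comm, ← hV]
  exact hcone τ
end

section
/- Let 2 ≤ m₀ ≤ m be natural numbers, and for k ∈ {m₀, m} define the spherical-cap hit probability P_k : ℝ → ℝ by P_k(τ) := (2 * ∫_{τ}^{1} (1 - z²)^{(k-3)/2} dz) / (∫_{-1}^{1} (1 - z²)^{(k-3)/2} dz), and set c_k := Real.Gamma (k/2) / (Real.sqrt π * Real.Gamma ((k-1)/2)). Let θ ∈ [0, π/2) satisfy Real.cos θ > c_{m₀} / c_m. Then there exists δ > 0 such that for all τ with 0 < τ < δ, P_{m₀}(τ / Real.cos θ) > P_m(τ). (Corollary 1: in the small-threshold regime, restricting the search from an m-dimensional space U to the m₀-dimensional symmetry slice U₀ = U ∩ N_S — which rescales the effective threshold by 1/cos θ — improves the boundary-crossing probability whenever cos θ exceeds the Gamma-ratio c_{m₀}/c_m, which behaves like √(m₀/m) for large m.) -/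
open MeasureTheory

/-- The integral of `(1 - z²)^(s-1)` over `[-1, 1]`, in terms of the Gamma function. -/
lemma integral_one_sub_sq_rpow {s : ℝ} (hs : 0 < s) :
    ∫ z in (-1 : ℝ)..1, (1 - z ^ 2) ^ (s - 1) =
      Real.sqrt Real.pi * Real.Gamma s / Real.Gamma (s + 1 / 2) := by
  have hbeta : ∫ x in (0 : ℝ)..1, x ^ (s - 1) * (1 - x) ^ (s - 1) =
      Real.Gamma s * Real.Gamma s / Real.Gamma (s + s) := by
    have h := ProbabilityTheory.beta_eq_betaIntegralReal s s hs hs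
    have h' : Complex.betaIntegral s s =
        ((∫ x in (0 : ℝ)..1, x ^ (s - 1) * (1 - x) ^ (s - 1) : ℝ) : ℂ) := by
      rw [Complex.betaIntegral, ← intervalIntegral.integral_ofReal]
      refine intervalIntegral.integral_congr fun x hx => ?_
      rw [Set.uIcc_of_le zero_le_one] at hx
      have h1 : 0 ≤ 1 - x := sub_nonneg.2 hx.2
      simp only [Complex.ofReal_mul, Complex.ofReal_cpow hx.1, Complex.ofReal_cpow h1]
      push_cast
      rfl
    rw [h', Complex.ofReal_re] at h
    exact h.symm
  have hsub := intervalIntegral.integral_comp_mul_sub (a := 0) (b := 1)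
    (fun z : ℝ => (1 - z ^ 2) ^ (s - 1)) (two_ne_zero (α := ℝ)) 1
  have hcongr : ∫ x in (0 : ℝ)..1, (1 - (2 * x - 1) ^ 2) ^ (s - 1) =
      (4 : ℝ) ^ (s - 1) * ∫ x in (0 : ℝ)..1, x ^ (s - 1) * (1 - x) ^ (s - 1) := by
    rw [← intervalIntegral.integral_const_mul]
    refine intervalIntegral.integral_congr fun x hx => ?_
    rw [Set.uIcc_of_le zero_le_one] at hx
    have h1 : 0 ≤ 1 - x := sub_nonneg.2 hx.2
    rw [← Real.mul_rpow hx.1 h1, ← Real.mul_rpow (by norm_num) (mul_nonneg hx.1 h1)]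
    ring_nf
  have hdup := Real.Gamma_mul_Gamma_add_half s
  have hG : 0 < Real.Gamma s := Real.Gamma_pos_of_pos hs
  have hG' : 0 < Real.Gamma (s + 1 / 2) := Real.Gamma_pos_of_pos (by linarith)
  have hG2 : 0 < Real.Gamma (2 * s) := Real.Gamma_pos_of_pos (by linarith)
  have hpow : (4 : ℝ) ^ (s - 1) * 2 * (2 : ℝ) ^ (1 - 2 * s) = 1 := by
    rw [show (4 : ℝ) = 2 ^ (2 : ℝ) by norm_num, ← Real.rpow_mul two_pos.le, mul_right_comm,
      ← Real.rpow_add two_pos, ← Real.rpow_add_one two_ne_zero]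
    ring_nf
    simp
  rw [hcongr, hbeta, ← two_mul] at hsub
  norm_num at hsub
  rw [eq_div_iff hG'.ne', show ∫ z in (-1 : ℝ)..1, (1 - z ^ 2) ^ (s - 1) =
    2 * ((4 : ℝ) ^ (s - 1) * (Real.Gamma s * Real.Gamma s / Real.Gamma (2 * s))) by
      rw [hsub]; ring]
  calc
    _ = (4 : ℝ) ^ (s - 1) * 2 * Real.Gamma s *
        (Real.Gamma s * Real.Gamma (s + 1 / 2)) / Real.Gamma (2 * s) := by ring
    _ = ((4 : ℝ) ^ (s - 1) * 2 * (2 : ℝ) ^ (1 - 2 * s)) *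
        (Real.sqrt Real.pi * Real.Gamma s) := by rw [hdup]; field_simp
    _ = _ := by rw [hpow, one_mul]

lemma integral_one_sub_sq_rpow_pos {s : ℝ} (hs : 0 < s) :
    0 < ∫ z in (-1 : ℝ)..1, (1 - z ^ 2) ^ (s - 1) := by
  rw [integral_one_sub_sq_rpow hs]
  have hG : 0 < Real.Gamma s := Real.Gamma_pos_of_pos hs
  have hG' : 0 < Real.Gamma (s + 1 / 2) := Real.Gamma_pos_of_pos (by linarith)
  positivity

lemma intervalIntegrable_one_sub_sq_rpow {s : ℝ} (hs : 0 < s) :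
    IntervalIntegrable (fun z : ℝ => (1 - z ^ 2) ^ (s - 1)) volume (-1) 1 := by
  by_contra h
  exact (integral_one_sub_sq_rpow_pos hs).ne' (intervalIntegral.integral_undef h)

lemma two_mul_integral_one_sub_sq_rpow {s : ℝ} (hs : 0 < s) :
    2 * ∫ z in (0 : ℝ)..1, (1 - z ^ 2) ^ (s - 1) =
      ∫ z in (-1 : ℝ)..1, (1 - z ^ 2) ^ (s - 1) := by
  have hint := intervalIntegrable_one_sub_sq_rpow hs
  have h := intervalIntegral.integral_comp_neg (a := 0) (b := 1)
    (fun z : ℝ => (1 - z ^ 2) ^ (s - 1))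
  simp only [neg_sq, neg_zero] at h
  rw [← intervalIntegral.integral_add_adjacent_intervals (a := -1) (b := 0) (c := 1), ← h, two_mul]
  all_goals
    refine hint.mono_set ?_
    rw [Set.uIcc_of_le (by norm_num), Set.uIcc_of_le (by norm_num)]
    exact Set.Icc_subset_Icc (by norm_num) (by norm_num)

lemma hasDerivAt_integral_one_sub_sq_rpow {s : ℝ} (hs : 0 < s) :
    HasDerivAt (fun τ : ℝ => ∫ z in τ..1, (1 - z ^ 2) ^ (s - 1)) (-1) 0 := by
  have hint : IntervalIntegrable (fun z : ℝ => (1 - z ^ 2) ^ (s - 1)) volume 0 1 := by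
    refine (intervalIntegrable_one_sub_sq_rpow hs).mono_set ?_
    rw [Set.uIcc_of_le (by norm_num), Set.uIcc_of_le (by norm_num)]
    exact Set.Icc_subset_Icc (by norm_num) le_rfl
  have hmeas : Measurable (fun z : ℝ => (1 - z ^ 2) ^ (s - 1)) := by fun_prop
  have hcont : ContinuousAt (fun z : ℝ => (1 - z ^ 2) ^ (s - 1)) 0 :=
    ContinuousAt.rpow_const (by fun_prop) (Or.inl (by norm_num))
  simpa using intervalIntegral.integral_hasDerivAt_left hint
    hmeas.stronglyMeasurable.stronglyMeasurableAtFilter hcont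

/-- If two functions agree at `a` and the derivative of `f` there is smaller than that of `g`,
then `f < g` immediately to the right of `a`. -/
lemma HasDerivAt.exists_forall_lt_right {f g : ℝ → ℝ} {f' g' a : ℝ} (hf : HasDerivAt f f' a)
    (hg : HasDerivAt g g' a) (hfg : f a = g a) (hlt : f' < g') :
    ∃ δ > 0, ∀ x, a < x → x < a + δ → f x < g x := by
  have h := (hasDerivAt_iff_tendsto_slope_left_right.1 (hg.sub hf)).2.eventually
    (lt_mem_nhds (sub_pos.2 hlt))
  obtain ⟨b, hb, hab⟩ := mem_nhdsGT_iff_exists_Ioo_subset.1 h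
  refine ⟨b - a, sub_pos.2 hb, fun x hx hxb => ?_⟩
  have hpos : 0 < slope (g - f) a x := hab ⟨hx, by linarith⟩
  rw [slope_def_field, lt_div_iff₀ (sub_pos.2 hx)] at hpos
  simp only [Pi.sub_apply, hfg] at hpos
  linarith

/-- Corollary 1: in the small-threshold regime, restricting the search from an
`m`-dimensional space to the `m₀`-dimensional symmetry slice (which rescales the
effective threshold by `1/cos θ`) improves the boundary-crossing probability
whenever `cos θ` exceeds the Gamma-ratio `c_{m₀}/c_m`. -/
theorem symmetry_slice_improves_hit_probability
    (m₀ m : ℕ) (hm₀ : 2 ≤ m₀) (hm : m₀ ≤ m)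
    (P : ℕ → ℝ → ℝ)
    (hP : ∀ (k : ℕ) (τ : ℝ), P k τ =
      (2 * ∫ z in τ..1, (1 - z ^ 2) ^ (((k : ℝ) - 3) / 2)) /
        ∫ z in (-1 : ℝ)..1, (1 - z ^ 2) ^ (((k : ℝ) - 3) / 2))
    (c : ℕ → ℝ)
    (hc : ∀ k : ℕ, c k =
      Real.Gamma ((k : ℝ) / 2) / (Real.sqrt Real.pi * Real.Gamma (((k : ℝ) - 1) / 2)))
    (θ : ℝ) (hθ : θ ∈ Set.Ico (0 : ℝ) (Real.pi / 2))
    (hcos : Real.cos θ > c m₀ / c m) :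
    ∃ δ > 0, ∀ τ : ℝ, 0 < τ → τ < δ → P m₀ (τ / Real.cos θ) > P m τ := by
  have hpos : ∀ k : ℕ, 2 ≤ k → 0 < ((k : ℝ) - 1) / 2 := fun k hk => by
    have : (2 : ℝ) ≤ k := by exact_mod_cast hk
    linarith
  have hexp : ∀ k : ℕ, ((k : ℝ) - 3) / 2 = ((k : ℝ) - 1) / 2 - 1 := fun k => by ring
  have hcpos : ∀ k : ℕ, 2 ≤ k → 0 < c k := fun k hk => by
    have h1 := Real.Gamma_pos_of_pos (hpos k hk)
    have h2 : 0 < Real.Gamma ((k : ℝ) / 2) :=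
      Real.Gamma_pos_of_pos (by linarith [hpos k hk])
    rw [hc]
    positivity
  have hI : ∀ k : ℕ, 2 ≤ k →
      ∫ z in (-1 : ℝ)..1, (1 - z ^ 2) ^ (((k : ℝ) - 3) / 2) = (c k)⁻¹ := fun k hk => by
    rw [hexp, integral_one_sub_sq_rpow (hpos k hk), hc, inv_div]
    ring_nf
  have hP0 : ∀ k : ℕ, 2 ≤ k → P k 0 = 1 := fun k hk => by
    rw [hP, hexp, two_mul_integral_one_sub_sq_rpow (hpos k hk)]
    exact div_self (integral_one_sub_sq_rpow_pos (hpos k hk)).ne'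
  have hderiv : ∀ k : ℕ, 2 ≤ k → HasDerivAt (P k) (-(2 * c k)) 0 := fun k hk => by
    have h := (hasDerivAt_integral_one_sub_sq_rpow (hpos k hk)).const_mul (2 * c k)
    rw [mul_neg_one] at h
    refine h.congr_of_eventuallyEq (Filter.Eventually.of_forall fun τ => ?_)
    rw [hP, hI k hk, hexp, div_inv_eq_mul]
    ring
  have hm2 : 2 ≤ m := hm₀.trans hm
  have hcosθ : 0 < Real.cos θ := (div_pos (hcpos m₀ hm₀) (hcpos m hm2)).trans hcos
  have hslice : HasDerivAt (fun τ => P m₀ (τ / Real.cos θ))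
      (-(2 * c m₀) * (1 / Real.cos θ)) 0 := by
    refine HasDerivAt.comp (0 : ℝ) ?_ ((hasDerivAt_id (0 : ℝ)).div_const _)
    simpa using hderiv m₀ hm₀
  have hlt : -(2 * c m) < -(2 * c m₀) * (1 / Real.cos θ) := by
    rw [gt_iff_lt, div_lt_iff₀ (hcpos m hm2)] at hcos
    rw [mul_one_div, lt_div_iff₀ hcosθ]
    linarith
  obtain ⟨δ, hδ, h⟩ := (hderiv m hm2).exists_forall_lt_right hslice
    (by simp [hP0 m hm2, hP0 m₀ hm₀]) hlt
  exact ⟨δ, hδ, fun τ h0 h1 => h τ h0 (by rwa [zero_add])⟩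
end

section
/- Let m₀ ≤ m be natural numbers with m ≥ 1, let μ be the Haar probability measure on the orthogonal group O(m) = Matrix.orthogonalGroup (Fin m) ℝ, and let n ∈ EuclideanSpace ℝ (Fin m) with ‖n‖ = 1. Then ∫_{O(m)} (∑_{i < m₀} ((Q : Matrix (Fin m) (Fin m) ℝ).mulVec n i)²) dμ(Q) = m₀ / m. (Expected squared projection of a fixed unit vector onto a uniformly random m₀-dimensional coordinate subspace: E‖P₀ Q n‖² = m₀/m; this is the mean of the Beta(m₀/2,(m−m₀)/2) variable B in Theorem 1, i.e. a random m₀-dimensional reduction retains on average the fraction m₀/m of the squared boundary normal.) -/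
open MeasureTheory

/-- The (Borel/pi) measurable structure on square matrices, transported from the
pi-type `Fin m → Fin m → ℝ`. -/
instance matrixMeasurableSpace (m : ℕ) : MeasurableSpace (Matrix (Fin m) (Fin m) ℝ) :=
  (inferInstance : MeasurableSpace (Fin m → Fin m → ℝ))

/-- The permutation matrix of `σ`, as an element of the orthogonal group. -/
noncomputable def permOrthogonal {m : ℕ} (σ : Equiv.Perm (Fin m)) :
    Matrix.orthogonalGroup (Fin m) ℝ :=
  ⟨σ.permMatrix ℝ, by
    rw [Matrix.mem_orthogonalGroup_iff, Matrix.transpose_permMatrix, ← Matrix.permMatrix_mul, inv_mul_cancel,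
      Matrix.permMatrix_one]⟩

lemma permOrthogonal_mul_apply {m : ℕ} (σ : Equiv.Perm (Fin m))
    (Q : Matrix.orthogonalGroup (Fin m) ℝ) (i j : Fin m) :
    ((permOrthogonal σ * Q : Matrix.orthogonalGroup (Fin m) ℝ) :
      Matrix (Fin m) (Fin m) ℝ) i j = (Q : Matrix (Fin m) (Fin m) ℝ) (σ i) j := by
  change (σ.permMatrix ℝ * (Q : Matrix (Fin m) (Fin m) ℝ)) i j = _
  rw [Equiv.Perm.permMatrix, PEquiv.toMatrix_toPEquiv_mul, Matrix.submatrix_apply, id_eq]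

lemma measurable_orthogonalGroup_apply {m : ℕ} (i j : Fin m) :
    Measurable fun Q : Matrix.orthogonalGroup (Fin m) ℝ =>
      (Q : Matrix (Fin m) (Fin m) ℝ) i j :=
  (measurable_pi_apply (X := fun _ : Fin m => ℝ) j).comp
    ((measurable_pi_apply (X := fun _ : Fin m => Fin m → ℝ) i).comp measurable_subtype_coe)

lemma measurable_permOrthogonal_mul {m : ℕ} (σ : Equiv.Perm (Fin m)) :
    Measurable fun Q : Matrix.orthogonalGroup (Fin m) ℝ => permOrthogonal σ * Q := by
  refine Measurable.subtype_mk (measurable_pi_lambda _ fun i => measurable_pi_lambda _ fun j => ?_)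
  have h := measurable_orthogonalGroup_apply (σ i) j
  simp only [← permOrthogonal_mul_apply] at h
  exact h

lemma measurable_orthogonalGroup_mulVec_sq {m : ℕ} (v : Fin m → ℝ) (i : Fin m) :
    Measurable fun Q : Matrix.orthogonalGroup (Fin m) ℝ =>
      ((Q : Matrix (Fin m) (Fin m) ℝ).mulVec v i) ^ 2 := by
  simp only [Matrix.mulVec, dotProduct]
  exact (Finset.measurable_fun_sum _ fun j _ =>
    (measurable_orthogonalGroup_apply i j).mul_const _).pow_const 2

lemma sum_orthogonalGroup_mulVec_sq {m : ℕ} (v : Fin m → ℝ)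
    (Q : Matrix.orthogonalGroup (Fin m) ℝ) :
    ∑ i, ((Q : Matrix (Fin m) (Fin m) ℝ).mulVec v i) ^ 2 = ∑ i, v i ^ 2 := by
  have hQ : (Q : Matrix (Fin m) (Fin m) ℝ).transpose * (Q : Matrix (Fin m) (Fin m) ℝ) = 1 :=
    (Matrix.mem_orthogonalGroup_iff' _ _).1 Q.2
  have h : (Q : Matrix (Fin m) (Fin m) ℝ).mulVec v ⬝ᵥ (Q : Matrix (Fin m) (Fin m) ℝ).mulVec v
      = v ⬝ᵥ v := by
    rw [Matrix.dotProduct_mulVec, ← Matrix.mulVec_transpose, Matrix.mulVec_mulVec, hQ,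
      Matrix.one_mulVec]
  simpa only [dotProduct, ← pow_two] using h

lemma integrable_orthogonalGroup_mulVec_sq {m : ℕ}
    (μ : Measure (Matrix.orthogonalGroup (Fin m) ℝ)) [IsFiniteMeasure μ]
    (v : Fin m → ℝ) (i : Fin m) :
    Integrable (fun Q : Matrix.orthogonalGroup (Fin m) ℝ =>
      ((Q : Matrix (Fin m) (Fin m) ℝ).mulVec v i) ^ 2) μ := by
  refine Integrable.of_bound (measurable_orthogonalGroup_mulVec_sq v i).aestronglyMeasurable
    (∑ k, v k ^ 2) (Filter.Eventually.of_forall fun Q => ?_)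
  rw [Real.norm_of_nonneg (sq_nonneg _), ← sum_orthogonalGroup_mulVec_sq v Q]
  exact Finset.single_le_sum
    (f := fun k => ((Q : Matrix (Fin m) (Fin m) ℝ).mulVec v k) ^ 2)
    (fun k _ => sq_nonneg _) (Finset.mem_univ i)

lemma integral_orthogonalGroup_mulVec_sq_eq {m : ℕ}
    (μ : Measure (Matrix.orthogonalGroup (Fin m) ℝ))
    (hinv : ∀ g : Matrix.orthogonalGroup (Fin m) ℝ, Measure.map (fun Q => g * Q) μ = μ)
    (v : Fin m → ℝ) (i j : Fin m) :
    ∫ Q : Matrix.orthogonalGroup (Fin m) ℝ, ((Q : Matrix (Fin m) (Fin m) ℝ).mulVec v i) ^ 2 ∂μ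
      = ∫ Q : Matrix.orthogonalGroup (Fin m) ℝ,
          ((Q : Matrix (Fin m) (Fin m) ℝ).mulVec v j) ^ 2 ∂μ := by
  conv_lhs => rw [← hinv (permOrthogonal (Equiv.swap i j))]
  rw [integral_map (measurable_permOrthogonal_mul _).aemeasurable
    (measurable_orthogonalGroup_mulVec_sq v i).aestronglyMeasurable]
  simp only [Matrix.mulVec, dotProduct, permOrthogonal_mul_apply, Equiv.swap_apply_left]

/-- Each coordinate of a Haar-rotated vector carries the same share of the squared norm. -/
lemma integral_orthogonalGroup_mulVec_sq {m : ℕ}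
    (μ : Measure (Matrix.orthogonalGroup (Fin m) ℝ)) [IsProbabilityMeasure μ]
    (hinv : ∀ g : Matrix.orthogonalGroup (Fin m) ℝ, Measure.map (fun Q => g * Q) μ = μ)
    (v : Fin m → ℝ) (i : Fin m) :
    ∫ Q : Matrix.orthogonalGroup (Fin m) ℝ, ((Q : Matrix (Fin m) (Fin m) ℝ).mulVec v i) ^ 2 ∂μ
      = (∑ k, v k ^ 2) / m := by
  have hm : (m : ℝ) ≠ 0 := by exact_mod_cast (Fin.pos i).ne'
  have h := integral_finsetSum (μ := μ) Finset.univ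
    fun k _ => integrable_orthogonalGroup_mulVec_sq μ v k
  simp only [sum_orthogonalGroup_mulVec_sq, integral_const, probReal_univ, one_smul,
    integral_orthogonalGroup_mulVec_sq_eq μ hinv v _ i, Finset.sum_const, Finset.card_univ,
    Fintype.card_fin, nsmul_eq_mul] at h
  rw [h, mul_div_cancel_left₀ _ hm]

/-- Expected squared projection of a fixed unit vector onto a uniformly random
`m₀`-dimensional coordinate subspace: `E ‖P₀ Q n‖² = m₀ / m`, where `Q` is a Haar
(left-invariant probability) random orthogonal matrix and `P₀` projects onto the
span of the first `m₀` standard basis vectors. -/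
theorem expected_squared_projection_random_subspace
    (m m₀ : ℕ) (hm : 1 ≤ m) (hm₀ : m₀ ≤ m)
    (μ : Measure (Matrix.orthogonalGroup (Fin m) ℝ)) [IsProbabilityMeasure μ]
    (hinv : ∀ g : Matrix.orthogonalGroup (Fin m) ℝ,
      Measure.map (fun Q => g * Q) μ = μ)
    (n : EuclideanSpace ℝ (Fin m)) (hn : ‖n‖ = 1) :
    ∫ Q : Matrix.orthogonalGroup (Fin m) ℝ,
        (∑ i ∈ Finset.univ.filter (fun i : Fin m => (i : ℕ) < m₀),
          ((Q : Matrix (Fin m) (Fin m) ℝ).mulVec (fun j => n j) i) ^ 2) ∂μ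
      = (m₀ : ℝ) / m := by
  have hsum : ∑ k, n k ^ 2 = 1 := by
    rw [← EuclideanSpace.real_norm_sq_eq, hn, one_pow]
  have hcard : (Finset.univ.filter fun i : Fin m => (i : ℕ) < m₀).card = m₀ := by
    rw [Fin.card_filter_val_lt, min_eq_right hm₀]
  rw [integral_finsetSum _ fun i _ => integrable_orthogonalGroup_mulVec_sq μ _ i]
  simp only [integral_orthogonalGroup_mulVec_sq μ hinv, hsum, Finset.sum_const, hcard,
    nsmul_eq_mul, mul_one_div]
end

section
/- Let (X, μ) be a finite measure space, d ≥ 1, and let e, φ : X → EuclideanSpace ℝ (Fin d) be bounded measurable functions. Let β > 0, v > 0, and define D : (X → EuclideanSpace ℝ (Fin d)) → ℝ by D(ψ) := ∫ ⟪e x, ψ x⟫² dμ(x) + β * ∫ (‖ψ x‖² - v²)² dμ(x), and set r : X → ℝ, r(x) := ⟪e x, φ x⟫. Then for every c ∈ EuclideanSpace ℝ (Fin d), the function t ↦ D(φ + t • c) (where (φ + t • c)(x) = φ(x) + t • c) is differentiable at t = 0 with derivative 2 * ∫ r(x) * ⟪e x, c⟫ dμ(x) + 4 * β * ∫ (‖φ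 x‖² - v²) * ⟪φ x, c⟫ dμ(x). Consequently, if t = 0 is a critical point of t ↦ D(φ + t • c) for every c, then for each i, ∫ r(x) * (e x)_i dμ(x) = -2 * β * ∫ (‖φ x‖² - v²) * (φ x)_i dμ(x). (The constant-variation constraints ⟨e_i, r⟩ = −2β⟨|φ|²−v², φ_i⟩ of the Euler–Lagrange equations, obtained by testing the auxiliary energy against constant variations; the gradient regularizer α‖∇φ‖² is unchanged by constant shifts and so contributes nothing.) -/
open scoped InnerProductSpace
open MeasureTheory

/-- The squared `L²` norm of `a + t b + t² c` has derivative `2 ∫ a b` at `t = 0`. -/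
theorem hasDerivAt_integral_sq_quadratic {X : Type*} [MeasurableSpace X] {μ : Measure X}
    {a b c : X → ℝ} (ha : MemLp a 2 μ) (hb : MemLp b 2 μ) (hc : MemLp c 2 μ) :
    HasDerivAt (fun t : ℝ => ∫ x, (a x + t * b x + t ^ 2 * c x) ^ 2 ∂μ)
      (2 * ∫ x, a x * b x ∂μ) 0 := by
  have haa : Integrable (fun x => a x * a x) μ := ha.integrable_mul ha
  have hab : Integrable (fun x => a x * b x) μ := ha.integrable_mul hb
  have hac : Integrable (fun x => a x * c x) μ := ha.integrable_mul hc
  have hbb : Integrable (fun x => b x * b x) μ := hb.integrable_mul hb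
  have hbc : Integrable (fun x => b x * c x) μ := hb.integrable_mul hc
  have hcc : Integrable (fun x => c x * c x) μ := hc.integrable_mul hc
  have expand : (fun t : ℝ => ∫ x, (a x + t * b x + t ^ 2 * c x) ^ 2 ∂μ) = fun t : ℝ =>
      (∫ x, a x * a x ∂μ) + t * (2 * ∫ x, a x * b x ∂μ)
        + t ^ 2 * ((∫ x, b x * b x ∂μ) + 2 * (∫ x, a x * c x ∂μ)
          + 2 * t * (∫ x, b x * c x ∂μ) + t ^ 2 * ∫ x, c x * c x ∂μ) := by
    funext t
    have pointwise : ∀ x, (a x + t * b x + t ^ 2 * c x) ^ 2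
        = a x * a x + (2 * t) * (a x * b x) + t ^ 2 * (b x * b x)
          + (2 * t ^ 2) * (a x * c x) + (2 * t ^ 3) * (b x * c x)
          + t ^ 4 * (c x * c x) := fun x => by ring
    simp_rw [pointwise]
    rw [integral_add (by fun_prop) (by fun_prop), integral_add (by fun_prop) (by fun_prop),
      integral_add (by fun_prop) (by fun_prop), integral_add (by fun_prop) (by fun_prop),
      integral_add (by fun_prop) (by fun_prop)]
    simp only [integral_const_mul]
    ring
  rw [expand]
  generalize (∫ x, a x * a x ∂μ) = A, (∫ x, a x * b x ∂μ) = B, (∫ x, b x * b x ∂μ) = C,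
    (∫ x, a x * c x ∂μ) = E, (∫ x, b x * c x ∂μ) = F, (∫ x, c x * c x ∂μ) = G
  have hid := hasDerivAt_id (0 : ℝ)
  have hpoly := ((hid.mul_const (2 * B)).const_add A).add
    ((hid.pow 2).mul ((((hid.const_mul 2).mul_const F).const_add (C + 2 * E)).add
      ((hid.pow 2).mul_const G)))
  refine hpoly.congr_deriv ?_
  simp

/-- Constant-variation constraints of the Euler–Lagrange equations: the derivative
of the (gradient-free part of the) auxiliary energy `D` along a constant variation
`c` is `2∫ r ⟪e, c⟫ + 4β∫ (‖φ‖² - v²) ⟪φ, c⟫`; if `t = 0` is a critical point for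
every constant variation `c`, then `⟨e_i, r⟩ = -2β ⟨‖φ‖² - v², φ_i⟩` for each `i`. -/
theorem constant_variation_constraints
    {X : Type*} [MeasurableSpace X] (μ : Measure X) [IsFiniteMeasure μ]
    (d : ℕ) (hd : 1 ≤ d)
    (e φ : X → EuclideanSpace ℝ (Fin d))
    (he : Measurable e) (hφ : Measurable φ)
    (Ce : ℝ) (hCe : ∀ x, ‖e x‖ ≤ Ce)
    (Cφ : ℝ) (hCφ : ∀ x, ‖φ x‖ ≤ Cφ)
    (β v : ℝ) (hβ : 0 < β) (hv : 0 < v)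
    (D : (X → EuclideanSpace ℝ (Fin d)) → ℝ)
    (hD : ∀ ψ : X → EuclideanSpace ℝ (Fin d),
      D ψ = ∫ x, ⟪e x, ψ x⟫_ℝ ^ 2 ∂μ + β * ∫ x, (‖ψ x‖ ^ 2 - v ^ 2) ^ 2 ∂μ)
    (r : X → ℝ) (hr : ∀ x, r x = ⟪e x, φ x⟫_ℝ) :
    (∀ c : EuclideanSpace ℝ (Fin d),
      HasDerivAt (fun t : ℝ => D (fun x => φ x + t • c))
        (2 * ∫ x, r x * ⟪e x, c⟫_ℝ ∂μ
          + 4 * β * ∫ x, (‖φ x‖ ^ 2 - v ^ 2) * ⟪φ x, c⟫_ℝ ∂μ) 0) ∧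
    ((∀ c : EuclideanSpace ℝ (Fin d),
        deriv (fun t : ℝ => D (fun x => φ x + t • c)) 0 = 0) →
      ∀ i : Fin d, ∫ x, r x * (e x i) ∂μ
        = -2 * β * ∫ x, (‖φ x‖ ^ 2 - v ^ 2) * (φ x i) ∂μ) := by
  have hderiv : ∀ c : EuclideanSpace ℝ (Fin d),
      HasDerivAt (fun t : ℝ => D (fun x => φ x + t • c))
        (2 * ∫ x, r x * ⟪e x, c⟫_ℝ ∂μ
          + 4 * β * ∫ x, (‖φ x‖ ^ 2 - v ^ 2) * ⟪φ x, c⟫_ℝ ∂μ) 0 := by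
    intro c
    have hr2 : MemLp r 2 μ := by
      refine MemLp.of_bound (C := Ce * Cφ) ?_ (.of_forall fun x => ?_)
      · rw [funext hr]
        exact (he.inner hφ).aestronglyMeasurable
      · rw [hr]
        exact (norm_inner_le_norm _ _).trans (mul_le_mul (hCe x) (hCφ x) (norm_nonneg _)
          ((norm_nonneg _).trans (hCe x)))
    have hec : MemLp (fun x => ⟪e x, c⟫_ℝ) 2 μ :=
      MemLp.of_bound (he.inner measurable_const).aestronglyMeasurable (Ce * ‖c‖)
        (.of_forall fun x => (norm_inner_le_norm _ _).trans
          (mul_le_mul_of_nonneg_right (hCe x) (norm_nonneg _)))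
    have hφc : MemLp (fun x => ⟪φ x, c⟫_ℝ) 2 μ :=
      MemLp.of_bound (hφ.inner measurable_const).aestronglyMeasurable (Cφ * ‖c‖)
        (.of_forall fun x => (norm_inner_le_norm _ _).trans
          (mul_le_mul_of_nonneg_right (hCφ x) (norm_nonneg _)))
    have hpot : MemLp (fun x => ‖φ x‖ ^ 2 - v ^ 2) 2 μ := by
      refine MemLp.of_bound (C := Cφ ^ 2 + v ^ 2)
        ((hφ.norm.pow_const 2).sub_const _).aestronglyMeasurable (.of_forall fun x => ?_)
      have hsq : ‖φ x‖ ^ 2 ≤ Cφ ^ 2 := pow_le_pow_left₀ (norm_nonneg _) (hCφ x) 2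
      rw [Real.norm_eq_abs, abs_le]
      constructor <;> nlinarith [sq_nonneg ‖φ x‖, sq_nonneg v, sq_nonneg Cφ]
    have hsignal := hasDerivAt_integral_sq_quadratic hr2 hec (memLp_const (0 : ℝ))
    have hpotential := hasDerivAt_integral_sq_quadratic hpot (hφc.const_mul 2)
      (memLp_const (‖c‖ ^ 2))
    have hsum := hsignal.add (hpotential.const_mul β)
    have hfun : (fun t : ℝ => D (fun x => φ x + t • c)) = fun t : ℝ =>
        (∫ x, (r x + t * ⟪e x, c⟫_ℝ + t ^ 2 * 0) ^ 2 ∂μ)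
          + β * ∫ x, (‖φ x‖ ^ 2 - v ^ 2 + t * (2 * ⟪φ x, c⟫_ℝ) + t ^ 2 * ‖c‖ ^ 2) ^ 2 ∂μ := by
      funext t
      rw [hD]
      congr 3
      · funext x
        rw [hr, inner_add_right, real_inner_smul_right]
        ring
      · funext x
        rw [norm_add_sq_real, real_inner_smul_right, norm_smul, mul_pow, Real.norm_eq_abs, sq_abs]
        ring
    rw [hfun]
    refine hsum.congr_deriv ?_
    simp_rw [mul_left_comm _ (2 : ℝ)]
    rw [integral_const_mul]
    ring
  refine ⟨hderiv, fun hcrit i => ?_⟩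
  have hzero := (hderiv (EuclideanSpace.single i 1)).deriv.symm.trans (hcrit _)
  simp only [EuclideanSpace.inner_single_right, one_mul, conj_trivial] at hzero
  linarith
end
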